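/- arXiv:2206.03094 — 6 statements merged into one kernel-verified Lean document; each statement's English description precedes it below -/
import Mathlib

section
/- Let n ≥ 1 and let E ⊆ ℝ × ℝⁿ be a Lebesgue measurable set such that for Lebesgue-a.e. y ∈ ℝⁿ there exists a set I_y ⊆ ℝ which is either ∅, or ℝ, or an open half-line (of the form (c,+∞) or (−∞,c) for some c ∈ ℝ) such that for Lebesgue-a.e. t ∈ ℝ one has (t,y) ∈ E if and only if t ∈ I_y. Then for every C¹ function φ : ℝ × ℝⁿ → ℝ with compact support and every compact set K ⊆ ℝⁿ such that the support of φ is contained in ℝ × K, one has |∫_E ∂₁φ(t,y) d(t,y)| ≤ λⁿ(K) · sup|φ|, where ∂₁φ denotes the partial derivative of φ in the first (ℝ-)variable, λⁿ is the n-dimensional Lebesgue measure, and the integral is with respect to the (n+1)-dimensional Lebesgue measure. In particular, the distributional derivative of the characteristic function of E in the first variable is a locally finite measure. -/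
open MeasureTheory Set

/-- A compactly supported function on a product has compactly supported horizontal slices. -/
theorem HasCompactSupport.comp_prodMk_right {X Y Z : Type*} [TopologicalSpace X] [R1Space X]
    [TopologicalSpace Y] [Zero Z] {φ : X × Y → Z} (hφ : HasCompactSupport φ) (y : Y) :
    HasCompactSupport fun x => φ (x, y) := by
  refine HasCompactSupport.intro (hφ.isCompact.image continuous_fst) fun x hx => ?_
  by_contra h
  exact hx ⟨(x, y), subset_tsupport φ h, rfl⟩

/-- The integral of the derivative of a compactly supported `C¹` function over `∅`, `ℝ` or an open
half-line is bounded by any bound on the function. -/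
theorem abs_setIntegral_deriv_le_of_halfLine {f : ℝ → ℝ} (hf : ContDiff ℝ 1 f)
    (hc : HasCompactSupport f) {M : ℝ} (hM : ∀ t, |f t| ≤ M) {I : Set ℝ}
    (hI : I = (∅ : Set ℝ) ∨ I = (univ : Set ℝ) ∨ (∃ c : ℝ, I = Ioi c) ∨ (∃ c : ℝ, I = Iio c)) :
    |∫ t in I, deriv f t| ≤ M := by
  have hM0 : 0 ≤ M := (abs_nonneg _).trans (hM 0)
  rcases hI with rfl | rfl | ⟨c, rfl⟩ | ⟨c, rfl⟩
  · simpa using hM0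
  · rw [setIntegral_univ, integral_eq_zero_of_hasDerivAt_of_integrable (f := f)
      (fun t => (hf.differentiable one_ne_zero t).hasDerivAt)
      ((hf.continuous_deriv le_rfl).integrable_of_hasCompactSupport hc.deriv)
      (hf.continuous.integrable_of_hasCompactSupport hc)]
    simpa using hM0
  · rw [hc.integral_Ioi_deriv_eq hf, abs_neg]
    exact hM c
  · rw [← integral_Iic_eq_integral_Iio, hc.integral_Iic_deriv_eq hf]
    exact hM c

/-- The partial derivative in the first variable is the Fréchet derivative in direction `(1, 0)`. -/
theorem deriv_comp_prodMk_right_eq_fderiv {F G : Type*} [NormedAddCommGroup F] [NormedSpace ℝ F]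
    [NormedAddCommGroup G] [NormedSpace ℝ G] {φ : ℝ × F → G} {p : ℝ × F}
    (hφ : DifferentiableAt ℝ φ p) :
    deriv (fun s : ℝ => φ (s, p.2)) p.1 = fderiv ℝ φ p (1, 0) :=
  (hφ.hasFDerivAt.comp_hasDerivAt_of_eq p.1
    ((hasDerivAt_id p.1).prodMk (hasDerivAt_const p.1 p.2)) rfl).deriv

/-- If `E ⊆ ℝ × ℝⁿ` is measurable and for a.e. `y` the slice `{t | (t,y) ∈ E}` agrees a.e.
with `∅`, `ℝ`, or an open half-line, then for every compactly supported `C¹` function `φ`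
whose support projects into a compact set `K ⊆ ℝⁿ`, the integral over `E` of the partial
derivative of `φ` in the first variable is bounded by `λⁿ(K) ⬝ sup |φ|`. -/
theorem monotone_slices_locally_finite_perimeter
    (n : ℕ) (hn : 1 ≤ n) (E : Set (ℝ × (Fin n → ℝ))) (hE : MeasurableSet E)
    (hslice : ∀ᵐ y : Fin n → ℝ, ∃ I : Set ℝ,
      (I = (∅ : Set ℝ) ∨ I = (univ : Set ℝ) ∨ (∃ c : ℝ, I = Ioi c) ∨ (∃ c : ℝ, I = Iio c)) ∧
      ∀ᵐ t : ℝ, ((t, y) ∈ E ↔ t ∈ I)) :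
    ∀ φ : ℝ × (Fin n → ℝ) → ℝ, ContDiff ℝ 1 φ → HasCompactSupport φ →
      ∀ K : Set (Fin n → ℝ), IsCompact K → tsupport φ ⊆ (univ : Set ℝ) ×ˢ K →
        |∫ p in E, deriv (fun s : ℝ => φ (s, p.2)) p.1| ≤
          (volume K).toReal * ⨆ x, |φ x| := by
  intro φ hφ hc K hK hsupp
  set M := ⨆ x, |φ x|
  have hM (x) : |φ x| ≤ M := by
    obtain ⟨C, hC⟩ := hc.exists_bound_of_continuous hφ.continuous
    exact le_ciSup (f := fun x => |φ x|) ⟨C, by rintro _ ⟨z, rfl⟩; exact hC z⟩ x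
  set g : ℝ × (Fin n → ℝ) → ℝ := fun p => deriv (fun s : ℝ => φ (s, p.2)) p.1 with hg
  have hg_int : Integrable g := by
    have hg_eq : g = fun p => fderiv ℝ φ p (1, 0) :=
      funext fun p => deriv_comp_prodMk_right_eq_fderiv (hφ.differentiable one_ne_zero p)
    rw [hg_eq]
    exact ((hφ.continuous_fderiv one_ne_zero).clm_apply
      continuous_const).integrable_of_hasCompactSupport (hc.fderiv_apply ℝ (1, 0))
  have hslice_le : ∀ᵐ y : Fin n → ℝ,
      ‖∫ t : ℝ, E.indicator g (t, y)‖ ≤ K.indicator (fun _ => M) y := by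
    filter_upwards [hslice] with y ⟨I, hI, hEI⟩
    by_cases hy : y ∈ K
    · have hI_meas : MeasurableSet I := by
        rcases hI with rfl | rfl | ⟨c, rfl⟩ | ⟨c, rfl⟩ <;> measurability
      have hEI' : (fun t : ℝ => E.indicator g (t, y)) =ᵐ[volume]
          I.indicator (deriv fun s : ℝ => φ (s, y)) := by
        filter_upwards [hEI] with t ht
        by_cases h : t ∈ I
        · rw [indicator_of_mem h, indicator_of_mem (ht.2 h)]
        · rw [indicator_of_notMem h, indicator_of_notMem (mt ht.1 h)]
      rw [indicator_of_mem hy, integral_congr_ae hEI', integral_indicator hI_meas]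
      exact abs_setIntegral_deriv_le_of_halfLine (hφ.comp (by fun_prop))
        (hc.comp_prodMk_right y) (fun t => hM (t, y)) hI
    · have hφ0 : (fun s : ℝ => φ (s, y)) = fun _ => 0 := by
        ext s
        by_contra h
        exact hy (hsupp (subset_tsupport φ h)).2
      have hg0 (t : ℝ) : E.indicator g (t, y) = 0 :=
        indicator_apply_eq_zero.2 fun _ => by simp [hg, hφ0]
      simp [hg0, hy]
  rw [← integral_indicator hE, Measure.volume_eq_prod,
    integral_prod_symm _ (hg_int.indicator hE), ← Real.norm_eq_abs]
  calc _ ≤ ∫ y, K.indicator (fun _ => M) y :=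
        norm_integral_le_of_norm_le
          ((integrable_indicator_iff hK.measurableSet).2
            (integrableOn_const hK.measure_lt_top.ne)) hslice_le
    _ = (volume K).toReal * M := by
        rw [integral_indicator_const _ hK.measurableSet, smul_eq_mul, Measure.real]
end

section
/- Let N ≥ n ≥ 1 be integers and let Γ : ℝᴺ → ℝⁿ be a C^∞ (smooth) map. Let V ⊆ ℝᴺ be an open set and let V′ ⊆ V be a set with λᴺ(V ∖ V′) = 0, where λᴺ denotes the N-dimensional Lebesgue measure (as an outer measure). Then λⁿ( Γ(V) ∖ Γ(V′) ) = 0, where λⁿ denotes the n-dimensional Lebesgue measure (as an outer measure) and Γ(V), Γ(V′) denote images. -/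
open MeasureTheory Set
open scoped ContDiff Topology NNReal

/-- Near a point where its derivative is surjective, a smooth map is the first component of a
smooth local diffeomorphism. -/
theorem exists_straightening {E F : Type*} [NormedAddCommGroup E] [NormedSpace ℝ E]
    [FiniteDimensional ℝ E] [NormedAddCommGroup F] [NormedSpace ℝ F] [FiniteDimensional ℝ F]
    {f : E → F} {U : Set E} (hU : IsOpen U) (hf : ContDiffOn ℝ ∞ f U) {a : E} (ha : a ∈ U)
    (hsurj : Function.Surjective (fderiv ℝ f a)) :
    ∃ e : OpenPartialHomeomorph E (F × (fderiv ℝ f a).ker),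
      a ∈ e.source ∧ e.source ⊆ U ∧ (∀ x, (e x).1 = f x) ∧
        ContDiffOn ℝ ∞ e e.source ∧ ContDiffOn ℝ ∞ e.symm e.target := by
  have := FiniteDimensional.complete ℝ E
  obtain ⟨P, hP⟩ := (fderiv ℝ f a).ker_closedComplemented_of_finiteDimensional_range
  have hΦ : ContDiffOn ℝ ∞ (fun x ↦ (f x, P x)) U := hf.prodMk P.contDiff.contDiffOn
  have hΦat : ∀ x ∈ U, ContDiffAt ℝ ∞ (fun x ↦ (f x, P x)) x :=
    fun x hx ↦ hΦ.contDiffAt (hU.mem_nhds hx)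
  have hbij : Function.Bijective ((fderiv ℝ f a).prod P) := by
    constructor
    · refine (injective_iff_map_eq_zero _).2 fun v hv ↦ ?_
      obtain ⟨h₁, h₂⟩ := Prod.ext_iff.1 hv
      have h₃ := hP ⟨v, h₁⟩
      exact congrArg Subtype.val (h₃.symm.trans h₂)
    · rintro ⟨y, k⟩
      obtain ⟨x, hx⟩ := hsurj y
      refine ⟨x - P x + k, Prod.ext ?_ ?_⟩
      · have h₁ : fderiv ℝ f a (P x) = 0 := (P x).2
        have h₂ : fderiv ℝ f a k = 0 := k.2
        simp [h₁, h₂, hx]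
      · simp [hP]
  let A : E ≃L[ℝ] F × (fderiv ℝ f a).ker :=
    (LinearEquiv.ofBijective ((fderiv ℝ f a).prod P).toLinearMap hbij).toContinuousLinearEquiv
  have hA : HasFDerivAt (fun x ↦ (f x, P x)) (A : E →L[ℝ] F × (fderiv ℝ f a).ker) a := by
    have h₁ := ((hf.contDiffAt (hU.mem_nhds ha)).differentiableAt (by simp)).hasFDerivAt
    exact h₁.prodMk P.hasFDerivAt
  let e₀ := (hΦat a ha).toOpenPartialHomeomorph _ hA (by simp)
  have hW : IsOpen (U ∩ fderiv ℝ (fun x ↦ (f x, P x)) ⁻¹'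
      range ((↑) : (E ≃L[ℝ] F × (fderiv ℝ f a).ker) → E →L[ℝ] F × (fderiv ℝ f a).ker)) :=
    (hΦ.continuousOn_fderiv_of_isOpen hU (by simp)).isOpen_inter_preimage hU
      ContinuousLinearEquiv.isOpen
  refine ⟨e₀.restrOpen _ hW, ?_, ?_, fun x ↦ rfl, ?_, ?_⟩
  · exact ⟨ContDiffAt.mem_toOpenPartialHomeomorph_source _ hA _, ha, A, hA.fderiv.symm⟩
  · exact fun x hx ↦ hx.2.1
  · exact hΦ.mono fun x hx ↦ hx.2.1
  · intro y hy
    have hx := (e₀.restrOpen _ hW).map_target hy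
    obtain ⟨B, hB⟩ := hx.2.2
    refine ((e₀.restrOpen _ hW).contDiffAt_symm hy (f₀' := B) ?_ (hΦat _ hx.2.1)).contDiffWithinAt
    rw [hB]
    exact ((hΦat _ hx.2.1).differentiableAt (by simp)).hasFDerivAt

/-- Locally uniform Taylor estimate at the points where all derivatives of orders `1, …, k`
vanish. -/
theorem exists_norm_sub_le_pow_of_iteratedFDeriv_eq_zero {E : Type} [NormedAddCommGroup E]
    [NormedSpace ℝ E] (k : ℕ) {F : Type} [NormedAddCommGroup F] [NormedSpace ℝ F] {g : E → F}
    {a : E} (hg : ContDiffAt ℝ (k + 1) g a) :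
    ∃ C : ℝ≥0, ∃ r > 0, ∀ x ∈ Metric.ball a r, ∀ y ∈ Metric.ball a r,
      (∀ j, 1 ≤ j → j ≤ k → iteratedFDeriv ℝ j g x = 0) →
        ‖g y - g x‖ ≤ C * ‖y - x‖ ^ (k + 1) := by
  induction k generalizing F with
  | zero =>
    obtain ⟨C, t, ht, hC⟩ := ContDiffAt.exists_lipschitzOnWith (by simpa using hg)
    obtain ⟨r, hr, hrt⟩ := Metric.mem_nhds_iff.1 ht
    refine ⟨C, r, hr, fun x hx y hy _ ↦ ?_⟩
    simpa using hC.norm_sub_le (hrt hy) (hrt hx)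
  | succ k ih =>
    obtain ⟨C, r, hr, h⟩ := ih (g := fderiv ℝ g) (hg.fderiv_right (by norm_cast))
    have hd : ∀ᶠ x in 𝓝 a, DifferentiableAt ℝ g x :=
      (hg.eventually (by norm_cast; exact ENat.natCast_ne_top _)).mono fun x hx ↦
        hx.differentiableAt (by norm_cast)
    obtain ⟨r', hr', hd⟩ := Metric.eventually_nhds_iff_ball.1 hd
    refine ⟨C, min r r', lt_min hr hr', fun x hx y hy hj ↦ ?_⟩
    have hseg : segment ℝ x y ⊆ Metric.ball a (min r r') := (convex_ball _ _).segment_subset hx hy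
    have h₀ : fderiv ℝ g x = 0 := by
      have := hj 1 le_rfl (by omega)
      rw [← norm_eq_zero] at this ⊢
      rwa [← norm_iteratedFDeriv_fderiv, norm_iteratedFDeriv_zero] at this
    have hbound : ∀ z ∈ segment ℝ x y, ‖fderiv ℝ g z‖ ≤ C * ‖y - x‖ ^ (k + 1) := by
      intro z hz
      have := h x (Metric.ball_subset_ball (min_le_left _ _) hx) z
        (Metric.ball_subset_ball (min_le_left _ _) (hseg hz)) fun j h1 h2 ↦ by
          rw [← norm_eq_zero, norm_iteratedFDeriv_fderiv, hj _ (by omega) (by omega), norm_zero]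
      rw [h₀, sub_zero] at this
      refine this.trans ?_
      gcongr
      exact norm_sub_le_of_mem_segment hz
    have := (convex_segment x y).norm_image_sub_le_of_norm_fderiv_le (𝕜 := ℝ)
      (fun z hz ↦ hd z (Metric.ball_subset_ball (min_le_right _ _) (hseg hz))) hbound
      (left_mem_segment ℝ x y) (right_mem_segment ℝ x y)
    rw [pow_succ, ← mul_assoc]
    exact this

/-- The image of a set is null if each of its points has a neighbourhood in the set with null
image. -/
theorem measure_image_null_of_locally_null {α β : Type*} [TopologicalSpace α]
    [SecondCountableTopology α] [MeasurableSpace β] (μ : Measure β) (f : α → β) {s : Set α}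
    (h : ∀ x ∈ s, ∃ u ∈ 𝓝 x, μ (f '' (s ∩ u)) = 0) : μ (f '' s) = 0 := by
  have := measure_null_of_locally_null (μ := OuterMeasure.comap f μ.toOuterMeasure) s fun x hx ↦ by
    obtain ⟨u, hu, h0⟩ := h x hx
    exact ⟨s ∩ u, inter_mem_nhdsWithin s hu, by simpa using h0⟩
  simpa using this

/-- A smooth real function maps the points where all derivatives up to the order of the dimension
vanish to a null set. -/
theorem volume_image_eq_zero_of_iteratedFDeriv_eq_zero {E : Type} [NormedAddCommGroup E]
    [NormedSpace ℝ E] [FiniteDimensional ℝ E] {g : E → ℝ} {s : Set E}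
    (hg : ∀ x ∈ s, ContDiffAt ℝ ∞ g x)
    (h : ∀ x ∈ s, ∀ j, 1 ≤ j → j ≤ Module.finrank ℝ E → iteratedFDeriv ℝ j g x = 0) :
    volume (g '' s) = 0 := by
  refine measure_image_null_of_locally_null _ _ fun a ha ↦ ?_
  obtain ⟨C, r, hr, hC⟩ := exists_norm_sub_le_pow_of_iteratedFDeriv_eq_zero
    (Module.finrank ℝ E) ((hg a ha).of_le (by exact_mod_cast le_top))
  refine ⟨_, Metric.ball_mem_nhds a hr, ?_⟩
  have hH : HolderOnWith C (Module.finrank ℝ E + 1) g (s ∩ Metric.ball a r) := by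
    intro x hx y hy
    have h₁ := hC x hx.2 y hy.2 (h x hx.1)
    rw [edist_comm, edist_comm x, edist_nndist, edist_nndist, nndist_eq_nnnorm, nndist_eq_nnnorm,
      ← ENNReal.coe_rpow_of_nonneg _ (by positivity), ← ENNReal.coe_mul, ENNReal.coe_le_coe,
      ← NNReal.coe_le_coe]
    push_cast
    exact_mod_cast h₁
  let : MeasurableSpace E := borel E
  have : BorelSpace E := ⟨rfl⟩
  rw [← hausdorffMeasure_real]
  refine nonpos_iff_eq_zero.1 ((hH.hausdorffMeasure_image_le (by positivity) zero_le_one).trans ?_)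
  have : Measure.hausdorffMeasure (((Module.finrank ℝ E + 1 : ℝ≥0) : ℝ) * 1)
      (s ∩ Metric.ball a r) = 0 := by
    rw [mul_one]
    apply hausdorffMeasure_of_dimH_lt
    refine (dimH_mono (subset_univ _)).trans_lt ?_
    rw [Real.dimH_univ_eq_finrank]
    exact_mod_cast Nat.lt_succ_self _
  rw [this, mul_zero]

/-- **Sard's theorem** for real functions: the critical values form a null set. -/
theorem volume_image_setOf_fderiv_eq_zero {E : Type} [NormedAddCommGroup E]
    [NormedSpace ℝ E] [FiniteDimensional ℝ E] {g : E → ℝ} {U : Set E} (hU : IsOpen U)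
    (hg : ContDiffOn ℝ ∞ g U) : volume (g '' {x ∈ U | fderiv ℝ g x = 0}) = 0 := by
  induction hd : Module.finrank ℝ E using Nat.strong_induction_on generalizing E with
  | _ d ih =>
  have hgat : ∀ x ∈ U, ContDiffAt ℝ ∞ g x := fun x hx ↦ hg.contDiffAt (hU.mem_nhds hx)
  have hB : volume (g '' {x ∈ U | ∀ j, 1 ≤ j → j ≤ Module.finrank ℝ E →
      iteratedFDeriv ℝ j g x = 0}) = 0 :=
    volume_image_eq_zero_of_iteratedFDeriv_eq_zero (fun x hx ↦ hgat x hx.1) fun x hx ↦ hx.2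
  have hS : ∀ k : ℕ, volume (g '' {x ∈ U | fderiv ℝ g x = 0 ∧ iteratedFDeriv ℝ k g x = 0 ∧
      iteratedFDeriv ℝ (k + 1) g x ≠ 0}) = 0 := by
    intro k
    refine measure_image_null_of_locally_null _ _ fun a ha ↦ ?_
    have hI : ∀ x ∈ U, ContDiffAt ℝ ∞ (iteratedFDeriv ℝ k g) x := fun x hx ↦
      (hgat x hx).iteratedFDeriv_right (by norm_cast)
    obtain ⟨v, hv⟩ : ∃ v, fderiv ℝ (fun y ↦ iteratedFDeriv ℝ k g y v) a ≠ 0 := by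
      by_contra! hcon
      have h₀ : fderiv ℝ (iteratedFDeriv ℝ k g) a = 0 := by
        ext u v
        have h₁ := ((hI a ha.1).differentiableAt (by simp)).hasFDerivAt
        have h₂ := (h₁.continuousMultilinear_apply_const v).fderiv.symm.trans (hcon v)
        simpa using congrArg (fun L ↦ L u) h₂
      refine ha.2.2.2 ?_
      rw [← norm_eq_zero, ← norm_fderiv_iteratedFDeriv, h₀]
      exact ContinuousLinearMap.opNorm_zero
    have hw : ContDiffOn ℝ ∞ (fun y ↦ iteratedFDeriv ℝ k g y v) U := fun x hx ↦
      ((ContinuousMultilinearMap.apply ℝ (fun _ : Fin k ↦ E) ℝ v).contDiff.contDiffAt.comp x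
        (hI x hx)).contDiffWithinAt
    obtain ⟨e, hae, heU, he, -, hesymm⟩ := exists_straightening hU hw ha.1
      (LinearMap.surjective (f := (fderiv ℝ (fun y ↦ iteratedFDeriv ℝ k g y v) a).toLinearMap)
        fun h ↦ hv (ContinuousLinearMap.coe_injective h))
    refine ⟨_, e.open_source.mem_nhds hae, ?_⟩
    have hT : IsOpen (Prod.mk (0 : ℝ) ⁻¹' e.target) := e.open_target.preimage (by fun_prop)
    have hφ : ContDiffOn ℝ ∞ (fun z ↦ e.symm (0, z)) (Prod.mk (0 : ℝ) ⁻¹' e.target) :=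
      hesymm.comp (by fun_prop) fun z hz ↦ hz
    refine measure_mono_null ?_ (ih _ ?_ hT (hg.comp hφ fun z hz ↦ heU (e.map_target hz)) rfl)
    · rintro - ⟨x, ⟨⟨hxU, hx₀, hxk, -⟩, hxe⟩, rfl⟩
      have hex : ((0 : ℝ), (e x).2) = e x := Prod.ext (by simp [he, hxk]) rfl
      have hsymm : e.symm (0, (e x).2) = x := by rw [hex, e.left_inv hxe]
      have hmem : (e x).2 ∈ Prod.mk (0 : ℝ) ⁻¹' e.target := by
        rw [mem_preimage, hex]
        exact e.map_source hxe
      refine ⟨(e x).2, ⟨hmem, ?_⟩, congrArg g hsymm⟩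
      have h₁ : HasFDerivAt g (fderiv ℝ g x) (e.symm (0, (e x).2)) := by
        rw [hsymm]
        exact ((hgat x hxU).differentiableAt (by simp)).hasFDerivAt
      have h₂ := ((hφ.contDiffAt (hT.mem_nhds hmem)).differentiableAt (by simp)).hasFDerivAt
      rw [hx₀] at h₁
      exact (HasFDerivAt.comp (e x).2 h₁ h₂).fderiv.trans (ContinuousLinearMap.zero_comp _)
    · rw [← hd]
      refine Submodule.finrank_lt fun htop ↦ hv ?_
      ext u
      exact (htop ▸ Submodule.mem_top : u ∈ (fderiv ℝ _ a).ker)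
  refine measure_mono_null ?_ (measure_union_null hB (measure_iUnion_null hS))
  rw [← image_iUnion, ← image_union]
  refine image_mono fun x hx ↦ ?_
  by_contra hcon
  simp only [mem_union, mem_iUnion, mem_ofPred_eq, not_or, not_exists, not_and, not_not] at hcon
  refine hcon.1 hx.1 fun j h1 _ ↦ ?_
  induction j, h1 using Nat.le_induction with
  | base =>
    rw [← norm_eq_zero, ← norm_iteratedFDeriv_fderiv, norm_iteratedFDeriv_zero, hx.2, norm_zero]
  | succ j _ ihj => exact hcon.2 j hx.1 hx.2 (ihj (by omega))

/-- If `p` is a submersion at the points of `s` and the derivative of the real function `q` vanishes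
there on the kernel of that of `p`, then `(p, q)` maps `s` to a null set. -/
theorem measure_image_prodMk_null_of_fderiv_eq_zero_on_ker {E F : Type} [NormedAddCommGroup E]
    [NormedSpace ℝ E] [FiniteDimensional ℝ E] [NormedAddCommGroup F] [NormedSpace ℝ F]
    [FiniteDimensional ℝ F] [MeasurableSpace F] [BorelSpace F] (μ : Measure F) [SFinite μ]
    {p : E → F} {q : E → ℝ} {U : Set E} (hU : IsOpen U)
    (hp : ContDiffOn ℝ ∞ p U) (hq : ContDiffOn ℝ ∞ q U) {s : Set E} (hsU : s ⊆ U)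
    (hsurj : ∀ x ∈ s, Function.Surjective (fderiv ℝ p x))
    (hker : ∀ x ∈ s, ∀ v, fderiv ℝ p x v = 0 → fderiv ℝ q x v = 0) :
    μ.prod volume ((fun x ↦ (p x, q x)) '' s) = 0 := by
  refine measure_image_null_of_locally_null _ _ fun a ha ↦ ?_
  obtain ⟨e, hae, heU, he, -, hesymm⟩ := exists_straightening hU hp (hsU ha) (hsurj a ha)
  have hG : ContDiffOn ℝ ∞ (fun z ↦ q (e.symm z)) e.target :=
    hq.comp hesymm fun z hz ↦ heU (e.map_target hz)
  obtain ⟨Q, hQ, hQT, hQc⟩ := local_compact_nhds (e.open_target.mem_nhds (e.map_source hae))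
  refine ⟨e.source ∩ e ⁻¹' Q, Filter.inter_mem (e.open_source.mem_nhds hae)
    ((e.continuousAt hae).preimage_mem_nhds hQ), ?_⟩
  let D := {z ∈ Q | (fderiv ℝ (fun z ↦ q (e.symm z)) z).comp
    (ContinuousLinearMap.inr ℝ F (fderiv ℝ p a).ker) = 0}
  have hDc : IsCompact D := by
    refine hQc.of_isClosed_subset ?_ (sep_subset _ _)
    have hcont : ContinuousOn (fun z ↦ (fderiv ℝ (fun z ↦ q (e.symm z)) z).comp
        (ContinuousLinearMap.inr ℝ F (fderiv ℝ p a).ker)) Q :=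
      ((hG.continuousOn_fderiv_of_isOpen e.open_target (by simp)).mono hQT).clm_comp
        continuousOn_const
    exact hcont.preimage_isClosed_of_isClosed hQc.isClosed isClosed_singleton
  refine measure_mono_null (t := (fun z ↦ (z.1, q (e.symm z))) '' D) ?_ ?_
  · rintro - ⟨x, ⟨hxs, hxe, hxQ⟩, rfl⟩
    refine ⟨e x, ⟨hxQ, ?_⟩, by simp [he, e.left_inv hxe]⟩
    have het := e.map_source hxe
    have h₁ := ((hq.contDiffAt (hU.mem_nhds (hsU hxs))).differentiableAt (by simp)).hasFDerivAt
    have h₂ := ((hp.contDiffAt (hU.mem_nhds (hsU hxs))).differentiableAt (by simp)).hasFDerivAt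
    have h₃ := ((hesymm.contDiffAt (e.open_target.mem_nhds het)).differentiableAt
      (by simp)).hasFDerivAt
    rw [← e.left_inv hxe] at h₁ h₂
    have h₄ : HasFDerivAt (fun z ↦ p (e.symm z)) (ContinuousLinearMap.fst ℝ F _) (e x) := by
      refine hasFDerivAt_fst.congr_of_eventuallyEq ?_
      filter_upwards [e.open_target.mem_nhds het] with z hz
      rw [← he, e.right_inv hz]
    have h₅ := (h₂.comp _ h₃).unique h₄
    have h₆ := (h₁.comp _ h₃).fderiv
    rw [e.left_inv hxe] at h₅ h₆
    change (fderiv ℝ (q ∘ e.symm) (e x)).comp _ = 0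
    rw [h₆]
    ext k
    exact hker x hxs _ (by simpa using congrArg (fun L ↦ L (0, k)) h₅)
  · have hcont : ContinuousOn (fun z ↦ (z.1, q (e.symm z))) D :=
      continuousOn_fst.prodMk (hG.continuousOn.mono ((sep_subset _ _).trans hQT))
    refine Measure.measure_prod_null_of_ae_null (hDc.image_of_continuousOn hcont).measurableSet ?_
    refine Filter.Eventually.of_forall fun t ↦ ?_
    have hT : IsOpen (Prod.mk t ⁻¹' e.target) := e.open_target.preimage (by fun_prop)
    have hGt : ContDiffOn ℝ ∞ (fun k ↦ q (e.symm (t, k))) (Prod.mk t ⁻¹' e.target) :=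
      hG.comp (contDiff_prodMk_right t).contDiffOn fun z hz ↦ hz
    refine measure_mono_null ?_ (volume_image_setOf_fderiv_eq_zero hT hGt)
    rintro y ⟨⟨t', k⟩, ⟨hzQ, hz⟩, hzy⟩
    obtain ⟨rfl, rfl⟩ := Prod.ext_iff.1 hzy
    refine ⟨k, ⟨hQT hzQ, ?_⟩, rfl⟩
    have h₁ := ((hG.contDiffAt (e.open_target.mem_nhds (hQT hzQ))).differentiableAt
      (by simp)).hasFDerivAt
    exact (h₁.comp k (hasFDerivAt_prodMk_right t' k)).fderiv.trans hz

/-- Preimages of null sets under surjective linear maps are null. -/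
theorem addHaar_preimage_null_of_surjective {E F : Type*} [NormedAddCommGroup E] [NormedSpace ℝ E]
    [FiniteDimensional ℝ E] [MeasurableSpace E] [BorelSpace E] [NormedAddCommGroup F]
    [NormedSpace ℝ F] [MeasurableSpace F] [BorelSpace F] (μ : Measure E) [μ.IsAddHaarMeasure]
    (ν : Measure F) [ν.IsAddHaarMeasure] {L : E →L[ℝ] F} (hL : Function.Surjective L) {s : Set F}
    (hs : ν s = 0) : μ (L ⁻¹' s) = 0 := by
  have : ProperSpace E := FiniteDimensional.proper ℝ E
  obtain ⟨c, -, hc⟩ := L.toLinearMap.exists_map_addHaar_eq_smul_addHaar μ ν hL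
  have hac : μ.map L ≪ ν := by
    change μ.map L.toLinearMap ≪ ν
    rw [hc]
    exact Measure.smul_absolutelyContinuous
  exact (Measure.QuasiMeasurePreserving.mk L.continuous.measurable hac).preimage_null hs

/-- **Sard's theorem**: the critical values of a smooth map form a null set. -/
theorem volume_image_setOf_not_surjective_fderiv {E : Type} [NormedAddCommGroup E]
    [NormedSpace ℝ E] [FiniteDimensional ℝ E] {n : ℕ} {f : E → Fin n → ℝ} {U : Set E}
    (hU : IsOpen U) (hf : ContDiffOn ℝ ∞ f U) :
    volume (f '' {x ∈ U | ¬ Function.Surjective (fderiv ℝ f x)}) = 0 := by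
  let π : ∀ i : ℕ, i ≤ n → (Fin n → ℝ) →L[ℝ] (Fin i → ℝ) := fun i hi ↦
    ContinuousLinearMap.pi fun j ↦ ContinuousLinearMap.proj (Fin.castLE hi j)
  have hstep : ∀ i : Fin n, volume (f '' {x ∈ U |
      Function.Surjective ((π i i.2.le).comp (fderiv ℝ f x)) ∧
        ¬ Function.Surjective ((π (i + 1) i.2).comp (fderiv ℝ f x))}) = 0 := by
    intro i
    have hfx : ∀ x ∈ U, HasFDerivAt f (fderiv ℝ f x) x := fun x hx ↦
      ((hf.contDiffAt (hU.mem_nhds hx)).differentiableAt (by simp)).hasFDerivAt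
    have hp : ∀ x ∈ U, fderiv ℝ (fun x ↦ π i i.2.le (f x)) x
        = (π i i.2.le).comp (fderiv ℝ f x) := fun x hx ↦
      ((π i i.2.le).hasFDerivAt.comp x (hfx x hx)).fderiv
    have hq : ∀ x ∈ U, fderiv ℝ (fun x ↦ f x i) x
        = (ContinuousLinearMap.proj i).comp (fderiv ℝ f x) := fun x hx ↦
      ((ContinuousLinearMap.proj (R := ℝ) (φ := fun _ : Fin n ↦ ℝ) i).hasFDerivAt.comp x
        (hfx x hx)).fderiv
    have hnull := measure_image_prodMk_null_of_fderiv_eq_zero_on_ker volume hU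
      (p := fun x ↦ π i i.2.le (f x)) (q := fun x ↦ f x i)
      (s := {x ∈ U | Function.Surjective ((π i i.2.le).comp (fderiv ℝ f x)) ∧
        ¬ Function.Surjective ((π (i + 1) i.2).comp (fderiv ℝ f x))})
      ((π i i.2.le).contDiff.comp_contDiffOn hf) (contDiffOn_pi.1 hf i) (sep_subset _ _)
      (fun x hx ↦ by rw [hp x hx.1]; exact hx.2.1)
      (fun x hx v hv ↦ by
        rw [hp x hx.1] at hv
        rw [hq x hx.1]
        by_contra hne
        change fderiv ℝ f x v i ≠ 0 at hne
        refine hx.2.2 fun y ↦ ?_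
        obtain ⟨u, hu⟩ := hx.2.1 (fun j ↦ y j.castSucc)
        refine ⟨u + ((y (Fin.last i) - fderiv ℝ f x u i) / fderiv ℝ f x v i) • v, ?_⟩
        ext j
        refine Fin.lastCases ?_ (fun j ↦ ?_) j
        · change fderiv ℝ f x (_ + _ • v) i = _
          simp [hne]
        · have h₁ : fderiv ℝ f x u (Fin.castLE i.2.le j) = y j.castSucc := congrFun hu j
          have h₂ : fderiv ℝ f x v (Fin.castLE i.2.le j) = 0 := congrFun hv j
          change fderiv ℝ f x (_ + _ • v) (Fin.castLE i.2.le j) = _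
          simp [h₁, h₂])
    have hsurj : Function.Surjective ((π i i.2.le).prod
        (ContinuousLinearMap.proj (R := ℝ) (φ := fun _ : Fin n ↦ ℝ) i)) := by
      rintro ⟨y, c⟩
      refine ⟨fun j ↦ if h : (j : ℕ) < i then y ⟨j, h⟩ else c, Prod.ext ?_ ?_⟩
      · ext j
        exact dif_pos j.2
      · simp
    refine measure_mono_null ?_ (addHaar_preimage_null_of_surjective volume
      ((volume : Measure (Fin i → ℝ)).prod volume) hsurj hnull)
    rintro - ⟨x, hx, rfl⟩
    exact ⟨x, hx, rfl⟩
  refine measure_mono_null ?_ (measure_iUnion_null hstep)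
  rw [← image_iUnion]
  refine image_mono fun x hx ↦ ?_
  by_contra hcon
  simp only [mem_iUnion, mem_ofPred_eq, not_exists, not_and, not_not] at hcon
  have hall : ∀ i (hi : i ≤ n), Function.Surjective ((π i hi).comp (fderiv ℝ f x)) := by
    intro i
    induction i with
    | zero => exact fun _ y ↦ ⟨0, Subsingleton.elim _ _⟩
    | succ i ih => exact fun hi ↦ hcon ⟨i, hi⟩ hx.1 (ih _)
  exact hx.2 (hall n le_rfl)

/-- Differentiable maps between spaces of equal dimension send null sets to null sets. -/
theorem addHaar_image_null_of_differentiableOn {E F : Type*} [NormedAddCommGroup E]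
    [NormedSpace ℝ E] [FiniteDimensional ℝ E] [MeasurableSpace E] [BorelSpace E]
    [NormedAddCommGroup F] [NormedSpace ℝ F] [FiniteDimensional ℝ F] [MeasurableSpace F]
    [BorelSpace F] (μ : Measure E) [μ.IsAddHaarMeasure] (ν : Measure F) [ν.IsAddHaarMeasure]
    (hdim : Module.finrank ℝ E = Module.finrank ℝ F) {f : E → F} {s : Set E}
    (hf : DifferentiableOn ℝ f s) (hs : μ s = 0) : ν (f '' s) = 0 := by
  let A : E ≃L[ℝ] F := ContinuousLinearEquiv.ofFinrankEq hdim
  have h₁ : μ ((fun x ↦ A.symm (f x)) '' s) = 0 :=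
    addHaar_image_eq_zero_of_differentiableOn_of_addHaar_eq_zero μ
      (A.symm.differentiable.comp_differentiableOn hf) hs
  have h₂ := addHaar_preimage_null_of_surjective ν μ (L := (A.symm : F →L[ℝ] E))
    A.symm.surjective h₁
  refine measure_mono_null ?_ h₂
  rintro - ⟨x, hx, rfl⟩
  exact ⟨x, hx, rfl⟩

/-- Near a regular point, removing a null set from the domain changes the image by a null set. -/
theorem exists_mem_nhds_measure_image_diff_image_null {E F : Type*} [NormedAddCommGroup E]
    [NormedSpace ℝ E] [FiniteDimensional ℝ E] [MeasurableSpace E] [BorelSpace E]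
    [NormedAddCommGroup F] [NormedSpace ℝ F] [FiniteDimensional ℝ F] [MeasurableSpace F]
    [BorelSpace F] (μ : Measure E) [μ.IsAddHaarMeasure] (ν : Measure F) [ν.IsAddHaarMeasure]
    {f : E → F} {U s : Set E} (hU : IsOpen U) (hf : ContDiffOn ℝ ∞ f U) (hs : μ (U \ s) = 0)
    {a : E} (ha : a ∈ U) (hsurj : Function.Surjective (fderiv ℝ f a)) :
    ∃ W ∈ 𝓝 a, ν (f '' W \ f '' s) = 0 := by
  obtain ⟨e, hae, heU, he, hesm, -⟩ := exists_straightening hU hf ha hsurj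
  refine ⟨e.source, e.open_source.mem_nhds hae, ?_⟩
  let K := (fderiv ℝ f a).ker
  let κ : Measure K := Measure.addHaar
  have hdim : Module.finrank ℝ E = Module.finrank ℝ (F × K) := by
    have h₁ := (fderiv ℝ f a).toLinearMap.finrank_range_add_finrank_ker
    rw [LinearMap.range_eq_top.2 hsurj, finrank_top] at h₁
    rw [Module.finrank_prod, ← h₁]
  have hZ : (ν.prod κ) (e '' (e.source \ s)) = 0 :=
    addHaar_image_null_of_differentiableOn μ _ hdim
      ((hesm.differentiableOn (by simp)).mono sdiff_subset)
      (measure_mono_null (sdiff_subset_sdiff_left heU) hs)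
  refine measure_mono_null ?_ (ae_iff.1 (Measure.measure_ae_null_of_prod_null hZ))
  rintro - ⟨⟨x, hx, rfl⟩, hxs⟩
  have hopen : IsOpen (Prod.mk (f x) ⁻¹' e.target) := e.open_target.preimage (by fun_prop)
  have hne : (Prod.mk (f x) ⁻¹' e.target).Nonempty :=
    ⟨(e x).2, by rw [mem_preimage, ← he x]; exact e.map_source hx⟩
  refine fun h0 ↦ (hopen.measure_pos κ hne).ne' (measure_mono_null (fun k hk ↦ ?_) h0)
  have hfk : f (e.symm (f x, k)) = f x := by rw [← he, e.right_inv hk]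
  exact ⟨e.symm (f x, k), ⟨e.map_target hk, fun hmem ↦ hxs ⟨_, hmem, hfk⟩⟩, e.right_inv hk⟩

/-- Sard–coarea argument: if `Γ : ℝᴺ → ℝⁿ` is smooth, `V ⊆ ℝᴺ` is open and `V' ⊆ V` has
full measure in `V`, then `Γ(V) \ Γ(V')` is Lebesgue null in `ℝⁿ`. -/
theorem image_of_full_measure_subset_of_open
    (N n : ℕ) (hn : 1 ≤ n) (hNn : n ≤ N)
    (Γ : (Fin N → ℝ) → (Fin n → ℝ)) (hΓ : ContDiff ℝ (⊤ : ℕ∞) Γ)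
    (V : Set (Fin N → ℝ)) (hV : IsOpen V)
    (V' : Set (Fin N → ℝ)) (hV' : V' ⊆ V) (hnull : volume (V \ V') = 0) :
    volume (Γ '' V \ Γ '' V') = 0 := by
  have hreg : volume (Γ '' {x ∈ V | Function.Surjective (fderiv ℝ Γ x) ∧ Γ x ∉ Γ '' V'}) = 0 := by
    refine measure_image_null_of_locally_null _ _ fun a ha ↦ ?_
    obtain ⟨W, hW, h0⟩ := exists_mem_nhds_measure_image_diff_image_null volume volume hV
      hΓ.contDiffOn hnull ha.1 ha.2.1
    refine ⟨W, hW, measure_mono_null ?_ h0⟩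
    rintro - ⟨x, ⟨hx, hxW⟩, rfl⟩
    exact ⟨⟨x, hxW, rfl⟩, hx.2.2⟩
  refine measure_mono_null ?_ (measure_union_null hreg
    (volume_image_setOf_not_surjective_fderiv hV hΓ.contDiffOn))
  rintro - ⟨⟨x, hx, rfl⟩, hxV'⟩
  by_cases hs : Function.Surjective (fderiv ℝ Γ x)
  · exact Or.inl ⟨x, ⟨hx, hs, hxV'⟩, rfl⟩
  · exact Or.inr ⟨x, ⟨hx, hs⟩, rfl⟩
end

section
/- Let (X,d) be a metric space, μ a locally finite Borel measure on X giving positive measure to every nonempty open ball, and E ⊆ X a μ-measurable set. Assume there is ε > 0 such that ∂_μ E = {x ∈ X : min{μ(E ∩ B(x,r)), μ(Eᶜ ∩ B(x,r))} > ε·μ(B(x,r)) for all r > 0}. Then Int_μ(E) = E₁. -/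
open MeasureTheory Metric Filter Topology Set

/-- Measure-theoretic support of a set: points all of whose balls meet the set in positive
measure. -/
def msSupport {X : Type*} [MetricSpace X] [MeasurableSpace X]
    (μ : Measure X) (E : Set X) : Set X :=
  {x : X | ∀ r : ℝ, 0 < r → 0 < μ (E ∩ ball x r)}

/-- Measure-theoretic interior of a set: complement of the measure-theoretic support of the
complement. -/
def msInterior {X : Type*} [MetricSpace X] [MeasurableSpace X]
    (μ : Measure X) (E : Set X) : Set X :=
  (msSupport μ Eᶜ)ᶜ

/-- Measure-theoretic boundary of a set. -/
def msBoundary {X : Type*} [MetricSpace X] [MeasurableSpace X]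
    (μ : Measure X) (E : Set X) : Set X :=
  msSupport μ E ∩ msSupport μ Eᶜ

/-- The set of density-one points of `E`. -/
def densityOnePoints {X : Type*} [MetricSpace X] [MeasurableSpace X]
    (μ : Measure X) (E : Set X) : Set X :=
  {x : X | Tendsto (fun r : ℝ => μ (E ∩ ball x r) / μ (ball x r)) (𝓝[>] 0) (𝓝 1)}

/-- The set of density-zero points of `E`. -/
def densityZeroPoints {X : Type*} [MetricSpace X] [MeasurableSpace X]
    (μ : Measure X) (E : Set X) : Set X :=
  {x : X | Tendsto (fun r : ℝ => μ (E ∩ ball x r) / μ (ball x r)) (𝓝[>] 0) (𝓝 0)}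

/-- The essential boundary of `E`. -/
def essBoundary {X : Type*} [MetricSpace X] [MeasurableSpace X]
    (μ : Measure X) (E : Set X) : Set X :=
  (densityZeroPoints μ E ∪ densityOnePoints μ E)ᶜ

/-- The measures of the traces of `E` and `Eᶜ` on a ball add up to the measure of the ball. -/
theorem measure_inter_ball_add_measure_compl_inter_ball {X : Type*} [MetricSpace X]
    [MeasurableSpace X] {μ : Measure X} {E : Set X} (hE : NullMeasurableSet E μ) (x : X) (r : ℝ) :
    μ (E ∩ ball x r) + μ (Eᶜ ∩ ball x r) = μ (ball x r) := by
  rw [inter_comm E, inter_comm Eᶜ, ← sdiff_eq]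
  exact measure_inter_add_sdiff₀ _ hE

/-- Small balls have finite measure for a locally finite measure. -/
theorem eventually_measure_ball_ne_top {X : Type*} [MetricSpace X] [MeasurableSpace X]
    (μ : Measure X) [IsLocallyFiniteMeasure μ] (x : X) :
    ∀ᶠ r : ℝ in 𝓝[>] 0, μ (ball x r) ≠ ⊤ := by
  obtain ⟨s, hs, hμs⟩ := μ.finiteAt_nhds x
  obtain ⟨R, hR, hball⟩ := Metric.mem_nhds_iff.1 hs
  filter_upwards [Ioo_mem_nhdsGT hR] with r hr
  exact ((measure_mono ((ball_subset_ball hr.2.le).trans hball)).trans_lt hμs).ne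

/-- A density-one point of `E` lies in the measure-theoretic support of `E`. -/
theorem densityOnePoints_subset_msSupport {X : Type*} [MetricSpace X] [MeasurableSpace X]
    (μ : Measure X) (E : Set X) : densityOnePoints μ E ⊆ msSupport μ E := by
  intro x hx R hR
  by_contra h
  have h0 : μ (E ∩ ball x R) = 0 := by simpa using h
  have hzero : ∀ᶠ r : ℝ in 𝓝[>] 0, μ (E ∩ ball x r) / μ (ball x r) = 0 := by
    filter_upwards [Ioo_mem_nhdsGT hR] with r hr
    rw [measure_mono_null (inter_subset_inter_right E (ball_subset_ball hr.2.le)) h0,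
      ENNReal.zero_div]
  exact zero_ne_one (tendsto_nhds_unique
    (tendsto_const_nhds.congr' (hzero.mono fun _ h => h.symm)) hx)

/-- Under the uniform lower density bound on the measure-theoretic boundary, the
measure-theoretic interior coincides with the set of density-one points. -/
theorem msInterior_eq_densityOnePoints
    {X : Type*} [MetricSpace X] [MeasurableSpace X] [BorelSpace X]
    (μ : Measure X) [IsLocallyFiniteMeasure μ]
    (hpos : ∀ (x : X) (r : ℝ), 0 < r → 0 < μ (ball x r))
    (E : Set X) (hE : NullMeasurableSet E μ)
    (ε : NNReal) (hε : 0 < ε)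
    (hbd : msBoundary μ E = {x : X | ∀ r : ℝ, 0 < r →
      (ε : ENNReal) * μ (ball x r) < min (μ (E ∩ ball x r)) (μ (Eᶜ ∩ ball x r))}) :
    msInterior μ E = densityOnePoints μ E := by
  ext x
  constructor
  · intro hx
    obtain ⟨R, hR, h0⟩ : ∃ R : ℝ, 0 < R ∧ μ (Eᶜ ∩ ball x R) = 0 := by
      simpa [msInterior, msSupport] using hx
    refine tendsto_const_nhds.congr' ?_
    filter_upwards [Ioo_mem_nhdsGT hR, eventually_measure_ball_ne_top μ x] with r hr hfin
    have hnull : μ (Eᶜ ∩ ball x r) = 0 :=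
      measure_mono_null (inter_subset_inter_right _ (ball_subset_ball hr.2.le)) h0
    have hadd := measure_inter_ball_add_measure_compl_inter_ball hE x r
    rw [hnull, add_zero] at hadd
    rw [hadd, ENNReal.div_self (hpos x r hr.1).ne' hfin]
  · intro hx hsupp
    have hmem : x ∈ msBoundary μ E := ⟨densityOnePoints_subset_msSupport μ E hx, hsupp⟩
    rw [hbd] at hmem
    have hle : ∀ᶠ r : ℝ in 𝓝[>] 0, μ (E ∩ ball x r) / μ (ball x r) + ε ≤ 1 := by
      filter_upwards [self_mem_nhdsWithin, eventually_measure_ball_ne_top μ x] with r hr hfin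
      have hne := (hpos x r hr).ne'
      calc μ (E ∩ ball x r) / μ (ball x r) + ε
          ≤ μ (E ∩ ball x r) / μ (ball x r) + μ (Eᶜ ∩ ball x r) / μ (ball x r) := by
            gcongr
            rw [ENNReal.le_div_iff_mul_le (.inl hne) (.inl hfin)]
            exact ((hmem r hr).trans_le (min_le_right _ _)).le
        _ = 1 := by
            rw [← ENNReal.add_div, measure_inter_ball_add_measure_compl_inter_ball hE,
              ENNReal.div_self hne hfin]
    have hlim : (1 : ENNReal) + ε ≤ 1 :=
      le_of_tendsto (Tendsto.add hx tendsto_const_nhds) hle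
    exact hlim.not_gt (ENNReal.lt_add_right ENNReal.one_ne_top (by exact_mod_cast hε.ne'))
end

section
/- Let (X,d) be a metric space, μ a locally finite Borel measure on X giving positive measure to every nonempty open ball, and E ⊆ X a μ-measurable set. Assume there is ε > 0 such that ∂_μ E = {x ∈ X : min{μ(E ∩ B(x,r)), μ(Eᶜ ∩ B(x,r))} > ε·μ(B(x,r)) for all r > 0}. Then spt_μ(E) = X ∖ E₀. -/
open MeasureTheory Metric Filter Topology Set

/-- A point outside the support of `E` is a density-zero point of `E`. -/
theorem compl_msSupport_subset_densityZeroPoints {X : Type*} [MetricSpace X] [MeasurableSpace X]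
    (μ : Measure X) (E : Set X) : (msSupport μ E)ᶜ ⊆ densityZeroPoints μ E := by
  intro x hx
  simp only [msSupport, mem_compl_iff, mem_ofPred_eq, not_forall, not_lt, nonpos_iff_eq_zero] at hx
  obtain ⟨R, hR, hzero⟩ := hx
  refine tendsto_const_nhds.congr' ?_
  filter_upwards [Ioo_mem_nhdsGT hR] with r hr
  rw [measure_mono_null (inter_subset_inter_right E (ball_subset_ball hr.2.le)) hzero,
    ENNReal.zero_div]

/-- A point at which the density of `E` is eventually bounded below by a positive constant is not
a density-zero point of `E`. -/
theorem notMem_densityZeroPoints_of_eventually_le {X : Type*} [MetricSpace X] [MeasurableSpace X]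
    {μ : Measure X} [IsLocallyFiniteMeasure μ] {E : Set X} {x : X}
    (hpos : ∀ r : ℝ, 0 < r → 0 < μ (ball x r)) {c : ENNReal} (hc : 0 < c)
    (hle : ∀ᶠ r in 𝓝[>] (0 : ℝ), c * μ (ball x r) ≤ μ (E ∩ ball x r)) :
    x ∉ densityZeroPoints μ E := by
  intro hx
  obtain ⟨U, hU, hUfin⟩ := μ.finiteAt_nhds x
  obtain ⟨R, hR, hRU⟩ := Metric.mem_nhds_iff.1 hU
  refine hc.not_ge (ge_of_tendsto hx ?_)
  filter_upwards [hle, Ioo_mem_nhdsGT hR] with r hr hrR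
  have hfin : μ (ball x r) ≠ ⊤ :=
    ((measure_mono ((ball_subset_ball hrR.2.le).trans hRU)).trans_lt hUfin).ne
  exact (ENNReal.le_div_iff_mul_le (Or.inl (hpos r hrR.1).ne') (Or.inl hfin)).2 hr

/-- Under the uniform lower density bound on the measure-theoretic boundary, the
measure-theoretic support coincides with the complement of the set of density-zero points. -/
theorem msSupport_eq_compl_densityZeroPoints
    {X : Type*} [MetricSpace X] [MeasurableSpace X] [BorelSpace X]
    (μ : Measure X) [IsLocallyFiniteMeasure μ]
    (hpos : ∀ (x : X) (r : ℝ), 0 < r → 0 < μ (ball x r))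
    (E : Set X) (hE : NullMeasurableSet E μ)
    (ε : NNReal) (hε : 0 < ε)
    (hbd : msBoundary μ E = {x : X | ∀ r : ℝ, 0 < r →
      (ε : ENNReal) * μ (ball x r) < min (μ (E ∩ ball x r)) (μ (Eᶜ ∩ ball x r))}) :
    msSupport μ E = (densityZeroPoints μ E)ᶜ := by
  refine Subset.antisymm (fun x hx => ?_)
    (compl_subset_comm.1 (compl_msSupport_subset_densityZeroPoints μ E))
  by_cases hxc : x ∈ msSupport μ Eᶜ
  · have hxb : x ∈ msBoundary μ E := ⟨hx, hxc⟩
    rw [hbd] at hxb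
    refine notMem_densityZeroPoints_of_eventually_le (hpos x) (ENNReal.coe_pos.2 hε) ?_
    filter_upwards [self_mem_nhdsWithin] with r hr
    exact (lt_min_iff.1 (hxb r hr)).1.le
  · simp only [msSupport, mem_ofPred_eq, not_forall, not_lt, nonpos_iff_eq_zero] at hxc
    obtain ⟨R, hR, hzero⟩ := hxc
    refine notMem_densityZeroPoints_of_eventually_le (hpos x) one_pos ?_
    filter_upwards [Ioo_mem_nhdsGT hR] with r hr
    have hnull : μ (Eᶜ ∩ ball x r) = 0 :=
      measure_mono_null (inter_subset_inter_right _ (ball_subset_ball hr.2.le)) hzero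
    calc 1 * μ (ball x r) = μ (E ∩ ball x r ∪ Eᶜ ∩ ball x r) := by
          rw [← union_inter_distrib_right, union_compl_self, univ_inter, one_mul]
      _ ≤ μ (E ∩ ball x r) + μ (Eᶜ ∩ ball x r) := measure_union_le _ _
      _ = μ (E ∩ ball x r) := by rw [hnull, add_zero]
end

section
/- Let (X,d) be a separable metric space and μ a nonzero locally finite Borel measure on X giving positive measure to every nonempty open ball and which is doubling: there is C > 0 with μ(B(x,2r)) ≤ C·μ(B(x,r)) for all x ∈ X and r > 0. Let E ⊆ X be a μ-measurable set and assume there is ε > 0 such that ∂_μ E = {x ∈ X : min{μ(E ∩ B(x,r)), μ(Eᶜ ∩ B(x,r))} > ε·μ(B(x,r)) for all r > 0}. Then ∂_μ E = ∂ Int_μ(E) = ∂ spt_μ(E), where ∂ denotes the topological boundary. -/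
open MeasureTheory Metric Filter Topology Set

theorem isClosed_msSupport {X : Type*} [MetricSpace X] [MeasurableSpace X]
    (μ : Measure X) (E : Set X) : IsClosed (msSupport μ E) := by
  refine isClosed_of_closure_subset fun x hx r hr => ?_
  obtain ⟨y, hy, hxy⟩ := Metric.mem_closure_iff.1 hx (r / 2) (half_pos hr)
  refine (hy (r / 2) (half_pos hr)).trans_le (measure_mono ?_)
  refine inter_subset_inter_right _ (ball_subset_ball' ?_)
  rw [dist_comm]
  linarith

theorem msSupport_union_msSupport_compl {X : Type*} [MetricSpace X] [MeasurableSpace X]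
    {μ : Measure X} (hpos : ∀ (x : X) (r : ℝ), 0 < r → 0 < μ (ball x r)) (E : Set X) :
    msSupport μ E ∪ msSupport μ Eᶜ = univ := by
  refine eq_univ_of_forall fun x => ?_
  by_contra hx
  simp only [msSupport, mem_union, mem_ofPred_eq, not_or, not_forall, not_lt, nonpos_iff_eq_zero,
    exists_prop] at hx
  obtain ⟨⟨r, hr, hEr⟩, s, hs, hEs⟩ := hx
  refine (hpos x (min r s) (lt_min hr hs)).ne' (measure_mono_null ?_ (measure_union_null hEr hEs))
  intro y hy
  by_cases hyE : y ∈ E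
  · exact Or.inl ⟨hyE, ball_subset_ball (min_le_left _ _) hy⟩
  · exact Or.inr ⟨hyE, ball_subset_ball (min_le_right _ _) hy⟩

theorem msBoundary_compl {X : Type*} [MetricSpace X] [MeasurableSpace X]
    (μ : Measure X) (E : Set X) : msBoundary μ Eᶜ = msBoundary μ E := by
  rw [msBoundary, msBoundary, compl_compl, inter_comm]

theorem isUnifLocDoublingMeasure_of_measure_ball_le {X : Type*} [MetricSpace X]
    [MeasurableSpace X] {μ : Measure X} {C : NNReal}
    (hdoub : ∀ (x : X) (r : ℝ), 0 < r → μ (ball x (2 * r)) ≤ (C : ENNReal) * μ (ball x r)) :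
    IsUnifLocDoublingMeasure μ := by
  refine ⟨C * C, ?_⟩
  filter_upwards [self_mem_nhdsWithin] with r (hr : 0 < r) x
  calc μ (closedBall x (2 * r)) ≤ μ (ball x (2 * (2 * r))) :=
        measure_mono (closedBall_subset_ball (by linarith))
    _ ≤ C * μ (ball x (2 * r)) := hdoub x _ (by linarith)
    _ ≤ C * (C * μ (ball x r)) := by gcongr; exact hdoub x r hr
    _ ≤ C * (C * μ (closedBall x r)) := by gcongr; exact ball_subset_closedBall
    _ = (C * C : NNReal) * μ (closedBall x r) := by rw [ENNReal.coe_mul, mul_assoc]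

/-- A uniform lower density bound for `E` at `x` is incompatible with `x` being a density-one
point of the complement of `E` along closed balls. -/
theorem not_tendsto_compl_density_of_lower_density {X : Type*} [MetricSpace X]
    [MeasurableSpace X] [BorelSpace X] {μ : Measure X} [IsLocallyFiniteMeasure μ]
    (hpos : ∀ (x : X) (r : ℝ), 0 < r → 0 < μ (ball x r)) {C : NNReal} (hC : 0 < C)
    (hdoub : ∀ (x : X) (r : ℝ), 0 < r → μ (ball x (2 * r)) ≤ (C : ENNReal) * μ (ball x r))
    {E : Set X} (hE : NullMeasurableSet E μ) {ε : NNReal} (hε : 0 < ε) {x : X}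
    (hx : ∀ r : ℝ, 0 < r → (ε : ENNReal) * μ (ball x r) ≤ μ (E ∩ ball x r)) :
    ¬ Tendsto (fun r : ℝ => μ (Eᶜ ∩ closedBall x r) / μ (closedBall x r)) (𝓝[>] 0) (𝓝 1) := by
  intro hlim
  have hfin : ∀ᶠ r in 𝓝[>] (0 : ℝ), μ (closedBall x r) < ⊤ := by
    obtain ⟨s, hs, hsfin⟩ := μ.finiteAt_nhds x
    obtain ⟨R, hR, hRs⟩ := Metric.nhds_basis_closedBall.mem_iff.1 hs
    filter_upwards [Ioc_mem_nhdsGT hR] with r hr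
    exact (measure_mono ((closedBall_subset_closedBall hr.2).trans hRs)).trans_lt hsfin
  have hbound : ∀ᶠ r in 𝓝[>] (0 : ℝ),
      μ (Eᶜ ∩ closedBall x r) / μ (closedBall x r) + ((ε / C : NNReal) : ENNReal) ≤ 1 := by
    filter_upwards [hfin, self_mem_nhdsWithin] with r hrfin (hr : 0 < r)
    have hm0 : μ (closedBall x r) ≠ 0 :=
      ((hpos x r hr).trans_le (measure_mono ball_subset_closedBall)).ne'
    have hlower : ((ε / C : NNReal) : ENNReal) * μ (closedBall x r) ≤ μ (E ∩ closedBall x r) :=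
      calc ((ε / C : NNReal) : ENNReal) * μ (closedBall x r)
          ≤ ((ε / C : NNReal) : ENNReal) * (C * μ (ball x r)) := by
            gcongr
            exact (measure_mono (closedBall_subset_ball (by linarith))).trans (hdoub x r hr)
        _ = ε * μ (ball x r) := by
            rw [← mul_assoc, ← ENNReal.coe_mul, div_mul_cancel₀ _ hC.ne']
        _ ≤ μ (E ∩ ball x r) := hx r hr
        _ ≤ μ (E ∩ closedBall x r) := by gcongr; exact ball_subset_closedBall
    have hsplit : μ (E ∩ closedBall x r) + μ (Eᶜ ∩ closedBall x r) = μ (closedBall x r) := by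
      rw [inter_comm E, inter_comm Eᶜ, ← sdiff_eq]
      exact measure_inter_add_sdiff₀ _ hE
    calc μ (Eᶜ ∩ closedBall x r) / μ (closedBall x r) + ((ε / C : NNReal) : ENNReal)
        ≤ μ (Eᶜ ∩ closedBall x r) / μ (closedBall x r)
          + μ (E ∩ closedBall x r) / μ (closedBall x r) := by
          gcongr
          exact (ENNReal.le_div_iff_mul_le (Or.inl hm0) (Or.inl hrfin.ne)).2 hlower
      _ = 1 := by
          rw [← ENNReal.add_div, add_comm, hsplit, ENNReal.div_self hm0 hrfin.ne]
  have hle : (1 : ENNReal) + ((ε / C : NNReal) : ENNReal) ≤ 1 :=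
    le_of_tendsto (hlim.add tendsto_const_nhds) hbound
  refine hle.not_gt (ENNReal.lt_add_right ENNReal.one_ne_top ?_)
  exact ENNReal.coe_ne_zero.2 (div_pos hε hC).ne'

theorem msBoundary_eq_frontier_msSupport_of_lower_density {X : Type*} [MetricSpace X]
    [TopologicalSpace.SeparableSpace X] [MeasurableSpace X] [BorelSpace X]
    {μ : Measure X} [IsLocallyFiniteMeasure μ]
    (hpos : ∀ (x : X) (r : ℝ), 0 < r → 0 < μ (ball x r)) {C : NNReal} (hC : 0 < C)
    (hdoub : ∀ (x : X) (r : ℝ), 0 < r → μ (ball x (2 * r)) ≤ (C : ENNReal) * μ (ball x r))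
    {E : Set X} (hE : NullMeasurableSet E μ) {ε : NNReal} (hε : 0 < ε)
    (hlow : ∀ x ∈ msBoundary μ E, ∀ r : ℝ, 0 < r →
      (ε : ENNReal) * μ (ball x r) ≤ μ (E ∩ ball x r)) :
    msBoundary μ E = frontier (msSupport μ E) := by
  rw [(isClosed_msSupport μ E).frontier_eq]
  refine Subset.antisymm (fun x hx => ⟨hx.1, fun hint => ?_⟩) fun x hx => ⟨hx.1, ?_⟩
  · obtain ⟨r, hr, hball⟩ := Metric.mem_nhds_iff.1 (mem_interior_iff_mem_nhds.1 hint)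
    have : SecondCountableTopology X := UniformSpace.secondCountable_of_separable X
    have : IsUnifLocDoublingMeasure μ := isUnifLocDoublingMeasure_of_measure_ball_le hdoub
    have hdens : ∀ᵐ y ∂μ, y ∈ Eᶜ →
        Tendsto (fun s : ℝ => μ (Eᶜ ∩ closedBall y s) / μ (closedBall y s)) (𝓝[>] 0) (𝓝 1) := by
      rw [← ae_restrict_iff'₀ hE.compl]
      filter_upwards [IsUnifLocDoublingMeasure.ae_tendsto_measure_inter_div μ Eᶜ 0] with y hy
      refine hy (fun _ => y) id tendsto_id (Eventually.of_forall fun s => ?_)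
      simp
    refine (hx.2 r hr).ne' (measure_mono_null ?_ (ae_iff.1 hdens))
    intro y hy hyd
    have hylim := hyd hy.1
    have hyc : y ∈ msSupport μ Eᶜ := by
      intro s hs
      obtain ⟨t, ht, hts⟩ := ((hylim.eventually_ne one_ne_zero).and
        (Ioo_mem_nhdsGT hs)).exists
      refine (pos_iff_ne_zero.2 fun h0 => ht ?_).trans_le
        (measure_mono (inter_subset_inter_right _ (closedBall_subset_ball hts.2)))
      rw [h0, ENNReal.zero_div]
    exact not_tendsto_compl_density_of_lower_density hpos hC hdoub hE hε
      (hlow y ⟨hball hy.2, hyc⟩) hylim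
  · by_contra hxc
    have hsub : (msSupport μ Eᶜ)ᶜ ⊆ msSupport μ E :=
      compl_subset_iff_union.2 (by rw [union_comm, msSupport_union_msSupport_compl hpos])
    exact hx.2 (interior_maximal hsub (isClosed_msSupport μ Eᶜ).isOpen_compl hxc)

/-- Under the uniform lower density bound on the measure-theoretic boundary of a set in a
doubling metric measure space, the measure-theoretic boundary coincides with the topological
boundaries of the measure-theoretic interior and of the measure-theoretic support. -/
theorem msBoundary_eq_frontier_msInterior_and_msSupport
    {X : Type*} [MetricSpace X] [TopologicalSpace.SeparableSpace X]
    [MeasurableSpace X] [BorelSpace X]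
    (μ : Measure X) [IsLocallyFiniteMeasure μ] (hμ : μ ≠ 0)
    (hpos : ∀ (x : X) (r : ℝ), 0 < r → 0 < μ (ball x r))
    (C : NNReal) (hC : 0 < C)
    (hdoub : ∀ (x : X) (r : ℝ), 0 < r →
      μ (ball x (2 * r)) ≤ (C : ENNReal) * μ (ball x r))
    (E : Set X) (hE : NullMeasurableSet E μ)
    (ε : NNReal) (hε : 0 < ε)
    (hbd : msBoundary μ E = {x : X | ∀ r : ℝ, 0 < r →
      (ε : ENNReal) * μ (ball x r) < min (μ (E ∩ ball x r)) (μ (Eᶜ ∩ ball x r))}) :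
    msBoundary μ E = frontier (msInterior μ E) ∧
    msBoundary μ E = frontier (msSupport μ E) := by
  have hlow : ∀ x ∈ msBoundary μ E, ∀ r : ℝ, 0 < r →
      (ε : ENNReal) * μ (ball x r) < min (μ (E ∩ ball x r)) (μ (Eᶜ ∩ ball x r)) :=
    fun x hx => hbd.subset hx
  constructor
  · rw [msInterior, frontier_compl, ← msBoundary_compl]
    refine msBoundary_eq_frontier_msSupport_of_lower_density hpos hC hdoub hE.compl hε ?_
    rw [msBoundary_compl]
    exact fun x hx r hr => (hlow x hx r hr).le.trans (min_le_right _ _)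
  · exact msBoundary_eq_frontier_msSupport_of_lower_density hpos hC hdoub hE hε
      fun x hx r hr => (hlow x hx r hr).le.trans (min_le_left _ _)
end

section
/- Let (X,d) be a separable metric space and μ a nonzero locally finite Borel measure on X giving positive measure to every nonempty open ball and which is doubling: there is C > 0 with μ(B(x,2r)) ≤ C·μ(B(x,r)) for all x ∈ X and r > 0. Let E ⊆ X be a μ-measurable set and assume there is ε > 0 such that ∂_μ E = {x ∈ X : min{μ(E ∩ B(x,r)), μ(Eᶜ ∩ B(x,r))} > ε·μ(B(x,r)) for all r > 0}. Then μ(E △ Int_μ(E)) = 0 and μ(E △ spt_μ(E)) = 0; that is, both Int_μ(E) and spt_μ(E) are measure-theoretic representatives of E. -/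
open MeasureTheory Metric Filter Topology Set

section

variable {X : Type*} [MetricSpace X] [MeasurableSpace X] {μ : Measure X}

/-- Doubling on open balls implies that the measure is uniformly locally doubling. -/
theorem isUnifLocDoublingMeasure_of_ball {C : NNReal}
    (hdoub : ∀ (x : X) (r : ℝ), 0 < r →
      μ (ball x (2 * r)) ≤ (C : ENNReal) * μ (ball x r)) :
    IsUnifLocDoublingMeasure μ := by
  refine ⟨C * C, ?_⟩
  filter_upwards [self_mem_nhdsWithin] with r hr x
  have hr : 0 < r := hr
  calc μ (closedBall x (2 * r))
      ≤ μ (ball x (2 * (2 * r))) := measure_mono (closedBall_subset_ball (by linarith))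
    _ ≤ C * μ (ball x (2 * r)) := hdoub x _ (by linarith)
    _ ≤ C * (C * μ (ball x r)) := by gcongr; exact hdoub x r hr
    _ ≤ C * (C * μ (closedBall x r)) := by gcongr; exact ball_subset_closedBall
    _ = ((C * C : NNReal) : ENNReal) * μ (closedBall x r) := by push_cast; ring

/-- Almost every point of a set belongs to its measure-theoretic support. -/
theorem measure_diff_msSupport [SecondCountableTopology X] (S : Set X) :
    μ (S \ msSupport μ S) = 0 := by
  refine measure_null_of_locally_null _ fun x hx => ?_
  have hx' := hx.2
  simp only [msSupport, mem_ofPred_eq, not_forall, not_lt, nonpos_iff_eq_zero] at hx'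
  obtain ⟨r, hr, h⟩ := hx'
  refine ⟨S ∩ ball x r, ?_, h⟩
  exact inter_mem (mem_of_superset self_mem_nhdsWithin sdiff_subset)
    (mem_nhdsWithin_of_mem_nhds (ball_mem_nhds x hr))

/-- The points of a set at which the complement has a uniform positive lower density on all
closed balls form a null set. -/
theorem measure_inter_compl_lower_density [SecondCountableTopology X] [BorelSpace X]
    [IsLocallyFiniteMeasure μ] [IsUnifLocDoublingMeasure μ]
    (hpos : ∀ (x : X) (r : ℝ), 0 < r → 0 < μ (ball x r))
    {S : Set X} (hS : NullMeasurableSet S μ) {c : ENNReal} (hc : 0 < c) :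
    μ (S ∩ {x | ∀ r : ℝ, 0 < r → c * μ (closedBall x r) ≤ μ (Sᶜ ∩ closedBall x r)}) = 0 := by
  have hae := (ae_restrict_iff'₀ hS).1
    (IsUnifLocDoublingMeasure.ae_tendsto_measure_inter_div μ S 1)
  refine measure_mono_null ?_ hae
  rintro x ⟨hxS, hx⟩ hlim
  have hlim := hlim hxS (l := 𝓝[>] (0 : ℝ)) (fun _ => x) id tendsto_id (by
    filter_upwards [self_mem_nhdsWithin] with r hr
    exact mem_closedBall_self (by simpa using (le_of_lt hr)))
  obtain ⟨u, hu, hufin⟩ := μ.finiteAt_nhds x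
  obtain ⟨R, hR, hRu⟩ := Metric.nhds_basis_closedBall.mem_iff.1 hu
  have hle : ∀ᶠ r in 𝓝[>] (0 : ℝ),
      μ (S ∩ closedBall x r) / μ (closedBall x r) + c ≤ 1 := by
    filter_upwards [Ioc_mem_nhdsGT hR] with r hr
    have h0 : μ (closedBall x r) ≠ 0 :=
      ((hpos x r hr.1).trans_le (measure_mono ball_subset_closedBall)).ne'
    have hfin : μ (closedBall x r) ≠ ⊤ :=
      ((measure_mono ((closedBall_subset_closedBall hr.2).trans hRu)).trans_lt hufin).ne
    have hsplit : μ (S ∩ closedBall x r) + μ (Sᶜ ∩ closedBall x r) = μ (closedBall x r) := by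
      rw [inter_comm S, inter_comm Sᶜ, ← sdiff_eq]
      exact measure_inter_add_sdiff₀ _ hS
    calc μ (S ∩ closedBall x r) / μ (closedBall x r) + c
        = (μ (S ∩ closedBall x r) + c * μ (closedBall x r)) / μ (closedBall x r) := by
          rw [ENNReal.add_div, ENNReal.mul_div_cancel_right h0 hfin]
      _ ≤ (μ (S ∩ closedBall x r) + μ (Sᶜ ∩ closedBall x r)) / μ (closedBall x r) := by
          gcongr
          exact hx r hr.1
      _ = 1 := by rw [hsplit, ENNReal.div_self h0 hfin]
  have hone : (1 : ENNReal) + c ≤ 1 := le_of_tendsto (hlim.add_const c) hle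
  exact absurd hone (not_le.2 (ENNReal.lt_add_right ENNReal.one_ne_top hc.ne'))

/-- If the measure-theoretic boundary is null, the measure-theoretic support is a
representative. -/
theorem measure_symmDiff_msSupport [SecondCountableTopology X] {S : Set X}
    (hbd : μ (msBoundary μ S) = 0) : μ (symmDiff S (msSupport μ S)) = 0 := by
  refine measure_mono_null (t := (S \ msSupport μ S) ∪ (Sᶜ \ msSupport μ Sᶜ) ∪ msBoundary μ S)
    ?_ (measure_union_null (measure_union_null (measure_diff_msSupport S)
      (measure_diff_msSupport Sᶜ)) hbd)
  rintro x (⟨h, h'⟩ | ⟨h, h'⟩)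
  · exact Or.inl (Or.inl ⟨h, h'⟩)
  · by_cases hx : x ∈ msSupport μ Sᶜ
    · exact Or.inr ⟨h, hx⟩
    · exact Or.inl (Or.inr ⟨h', hx⟩)

theorem msBoundary_compl_s9 (S : Set X) : msBoundary μ Sᶜ = msBoundary μ S := by
  simp [msBoundary, inter_comm]

end

/-- Under the uniform lower density bound on the measure-theoretic boundary of a set in a
doubling metric measure space, both the measure-theoretic interior and the measure-theoretic
support are measure-theoretic representatives of the set. -/
theorem msInterior_and_msSupport_are_representatives
    {X : Type*} [MetricSpace X] [TopologicalSpace.SeparableSpace X]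
    [MeasurableSpace X] [BorelSpace X]
    (μ : Measure X) [IsLocallyFiniteMeasure μ] (hμ : μ ≠ 0)
    (hpos : ∀ (x : X) (r : ℝ), 0 < r → 0 < μ (ball x r))
    (C : NNReal) (hC : 0 < C)
    (hdoub : ∀ (x : X) (r : ℝ), 0 < r →
      μ (ball x (2 * r)) ≤ (C : ENNReal) * μ (ball x r))
    (E : Set X) (hE : NullMeasurableSet E μ)
    (ε : NNReal) (hε : 0 < ε)
    (hbd : msBoundary μ E = {x : X | ∀ r : ℝ, 0 < r →
      (ε : ENNReal) * μ (ball x r) < min (μ (E ∩ ball x r)) (μ (Eᶜ ∩ ball x r))}) :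
    μ (symmDiff E (msInterior μ E)) = 0 ∧ μ (symmDiff E (msSupport μ E)) = 0 := by
  have : SecondCountableTopology X := UniformSpace.secondCountable_of_separable X
  have : IsUnifLocDoublingMeasure μ := isUnifLocDoublingMeasure_of_ball hdoub
  have hC0 : (C : ENNReal) ≠ 0 := by exact_mod_cast hC.ne'
  have hc : 0 < (ε : ENNReal) / C := ENNReal.div_pos (by exact_mod_cast hε.ne') ENNReal.coe_ne_top
  have hball : ∀ (x : X) (r : ℝ), 0 < r →
      (ε : ENNReal) / C * μ (closedBall x r) ≤ ε * μ (ball x r) := by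
    intro x r hr
    calc (ε : ENNReal) / C * μ (closedBall x r)
        ≤ ε / C * (C * μ (ball x r)) := by
          gcongr
          exact (measure_mono (closedBall_subset_ball (by linarith))).trans (hdoub x r hr)
      _ = ε * μ (ball x r) := by
          rw [← mul_assoc, ENNReal.div_mul_cancel hC0 ENNReal.coe_ne_top]
  have hnull : μ (msBoundary μ E) = 0 := by
    refine measure_mono_null ?_ (measure_union_null
      (measure_inter_compl_lower_density hpos hE hc)
      (measure_inter_compl_lower_density hpos hE.compl hc))
    intro x hx
    rw [hbd] at hx
    by_cases hxE : x ∈ E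
    · refine Or.inl ⟨hxE, fun r hr => (hball x r hr).trans ?_⟩
      exact ((hx r hr).le.trans (min_le_right _ _)).trans
        (measure_mono (inter_subset_inter_right _ ball_subset_closedBall))
    · refine Or.inr ⟨hxE, fun r hr => (hball x r hr).trans ?_⟩
      rw [compl_compl]
      exact ((hx r hr).le.trans (min_le_left _ _)).trans
        (measure_mono (inter_subset_inter_right _ ball_subset_closedBall))
  refine ⟨?_, measure_symmDiff_msSupport hnull⟩
  rw [msInterior, ← compl_symmDiff_compl, compl_compl]
  exact measure_symmDiff_msSupport (by rwa [msBoundary_compl_s9])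
end
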